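/- Let K be a field and let φ be a 5×5 alternating matrix of linear forms in x_1,...,x_5 over K, all of whose 4×4 Pfaffians are identically zero. Then φ is equivalent, under the action (A,B)·φ = AφA^T composed with the linear substitution of variables by B (A, B ∈ GL_5(K)), to a matrix whose only nonzero entries (up to sign) lie in the first row, or to the matrix with entries φ_{12} = x_1, φ_{13} = x_2, φ_{23} = x_3 and all other entries above the diagonal zero. -/

import Mathlib

open Matrix

open MvPolynomial

/-- The Pfaffian of a 4×4 alternating matrix. -/
def pf4 {R : Type*} [CommRing R] (M : Matrix (Fin 4) (Fin 4) R) : R :=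
  M 0 1 * M 2 3 - M 0 2 * M 1 3 + M 0 3 * M 1 2

/-- The vector of signed 4×4 Pfaffians of a 5×5 alternating matrix. -/
def signedPf {R : Type*} [CommRing R] (M : Matrix (Fin 5) (Fin 5) R) (i : Fin 5) : R :=
  (-1 : R) ^ (i : ℕ) * pf4 (M.submatrix i.succAbove i.succAbove)

/-- The action of `[A,B]` on a genus one model of degree 5:
`Φ ↦ A Φ Aᵀ` followed by the substitution `x_j ↦ ∑_i B_{ij} x_i`. -/
noncomputable def transformModel {K : Type*} [Field K]
    (A B : Matrix (Fin 5) (Fin 5) K)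
    (Φ : Matrix (Fin 5) (Fin 5) (MvPolynomial (Fin 5) K)) :
    Matrix (Fin 5) (Fin 5) (MvPolynomial (Fin 5) K) :=
  let M : Matrix (Fin 5) (Fin 5) (MvPolynomial (Fin 5) K) :=
    (A.map C) * Φ * (A.map C)ᵀ
  fun i j => (aeval fun k => ∑ l, C (B l k) * X l) (M i j)


section helpers

variable {K : Type*} [Field K]

/-- The linear form with coefficient vector `v`. -/
noncomputable def linForm (v : Fin 5 → K) : MvPolynomial (Fin 5) K := ∑ k, C (v k) * X k

lemma exists_linForm {f : MvPolynomial (Fin 5) K} (hf : f.IsHomogeneous 1) :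
    ∃ v, f = linForm v := by
  rw [← mem_homogeneousSubmodule, homogeneousSubmodule_one_eq_span_X,
    Submodule.mem_span_range_iff_exists_fun] at hf
  obtain ⟨c, hc⟩ := hf
  exact ⟨c, by simp [linForm, ← hc, smul_eq_C_mul]⟩

lemma pderiv_linForm (v : Fin 5 → K) (k : Fin 5) : pderiv k (linForm v) = C (v k) := by
  simp [linForm, pderiv_X, Pi.single_apply]

lemma eval_linForm (v w : Fin 5 → K) : eval w (linForm v) = ∑ k, v k * w k := by
  simp [linForm]

lemma linForm_zero : linForm (0 : Fin 5 → K) = 0 := by simp [linForm]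

lemma linForm_eq_zero (v : Fin 5 → K) (h : linForm v = 0) : v = 0 := by
  funext k
  have := pderiv_linForm v k
  rw [h, map_zero] at this
  exact (C_eq_zero.1 this.symm)

/-- coefficient of `X k` of a linear form -/
noncomputable def lc (k : Fin 5) (f : MvPolynomial (Fin 5) K) : K := eval (Pi.single k 1) f

lemma lc_linForm (v : Fin 5 → K) (k : Fin 5) : lc k (linForm v) = v k := by
  simp [lc, eval_linForm, Pi.single_apply]

lemma pderiv_hom {f : MvPolynomial (Fin 5) K} (hf : f.IsHomogeneous 1) (k : Fin 5) :
    pderiv k f = C (lc k f) := by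
  obtain ⟨v, rfl⟩ := exists_linForm hf
  rw [pderiv_linForm, lc_linForm]

lemma exists_lc_ne_zero {f : MvPolynomial (Fin 5) K} (hf : f.IsHomogeneous 1) (h0 : f ≠ 0) :
    ∃ k, lc k f ≠ 0 := by
  obtain ⟨v, rfl⟩ := exists_linForm hf
  by_contra! h
  apply h0
  have : v = 0 := by funext k; simpa [lc_linForm] using h k
  rw [this, linForm_zero]

lemma dvd_hom {f g : MvPolynomial (Fin 5) K} (hf : f.IsHomogeneous 1) (hg : g.IsHomogeneous 1)
    (h : g ∣ f) : ∃ t : K, f = C t * g := by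
  obtain ⟨q, rfl⟩ := h
  by_cases h0 : g * q = 0
  · exact ⟨0, by simp [h0]⟩
  have hg0 := left_ne_zero_of_mul h0
  have hq0 := right_ne_zero_of_mul h0
  have h1 := hf.totalDegree h0
  rw [totalDegree_mul_of_isDomain hg0 hq0, hg.totalDegree hg0] at h1
  have h2 : q.totalDegree = 0 := by omega
  rw [totalDegree_eq_zero_iff_eq_C] at h2
  exact ⟨coeff 0 q, by rw [mul_comm]; exact congrArg (· * g) h2⟩

lemma prime_hom {g : MvPolynomial (Fin 5) K} (hg : g.IsHomogeneous 1) (h0 : g ≠ 0) :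
    Prime g := by
  apply Irreducible.prime
  apply irreducible_of_totalDegree_eq_one (hg.totalDegree h0)
  intro x hx
  obtain ⟨d, hd⟩ := ne_zero_iff.1 h0
  refine (isUnit_iff_ne_zero).2 ?_
  rintro rfl
  exact hd (by simpa using hx d)

/-- key vanishing lemma -/
lemma key_vanish {k : Fin 5} {f g a b c d : MvPolynomial (Fin 5) K}
    (hf : f.IsHomogeneous 1) (hg : g.IsHomogeneous 1) (ha : a.IsHomogeneous 1)
    (hb : b.IsHomogeneous 1) (hc : c.IsHomogeneous 1) (hd : d.IsHomogeneous 1)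
    (f1 : lc k f = 1) (a0 : lc k a = 0) (b0 : lc k b = 0) (c0 : lc k c = 0) (d0 : lc k d = 0)
    (h : f * g - a * b + c * d = 0) : g = 0 := by
  have hl : lc k g = 0 := by
    have := congrArg (lc k) h
    simp only [lc] at *
    simpa [f1, a0, b0, c0, d0] using this
  have := congrArg (pderiv k) h
  simpa only [map_add, map_sub, Derivation.leibniz, pderiv_hom hf, pderiv_hom hg, pderiv_hom ha,
    pderiv_hom hb, pderiv_hom hc, pderiv_hom hd, f1, a0, b0, c0, d0, hl, smul_eq_mul, map_one,
    map_zero, mul_zero, mul_one, zero_add, add_zero, sub_zero] using this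

/-- Plücker expression -/
def plu {R : Type*} [CommRing R] (M : Matrix (Fin 5) (Fin 5) R) (i j k l : Fin 5) : R :=
  M i j * M k l - M i k * M j l + M i l * M j k

structure Good (M : Matrix (Fin 5) (Fin 5) (MvPolynomial (Fin 5) K)) : Prop where
  lin : ∀ i j, (M i j).IsHomogeneous 1
  alt : ∀ i j, M i j = - M j i
  diag : ∀ i, M i i = 0
  plu : ∀ i j k l, plu M i j k l = 0

lemma plu_swap1 {R : Type*} [CommRing R] {M : Matrix (Fin 5) (Fin 5) R}
    (alt : ∀ i j, M i j = - M j i) (i j k l : Fin 5) : plu M i j k l = - plu M j i k l := by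
  unfold plu; rw [alt j i]; ring

lemma plu_swap2 {R : Type*} [CommRing R] {M : Matrix (Fin 5) (Fin 5) R}
    (alt : ∀ i j, M i j = - M j i) (i j k l : Fin 5) : plu M i j k l = - plu M i k j l := by
  unfold plu; rw [alt k j]; ring

lemma plu_swap3 {R : Type*} [CommRing R] {M : Matrix (Fin 5) (Fin 5) R}
    (alt : ∀ i j, M i j = - M j i) (i j k l : Fin 5) : plu M i j k l = - plu M i j l k := by
  unfold plu; rw [alt l k]; ring

lemma plu_all {R : Type*} [CommRing R] {M : Matrix (Fin 5) (Fin 5) R}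
    (alt : ∀ i j, M i j = - M j i) (diag : ∀ i, M i i = 0)
    (h : ∀ i, signedPf M i = 0) (i j k l : Fin 5) : plu M i j k l = 0 := by
  have s1 := plu_swap1 alt
  have s2 := plu_swap2 alt
  have s3 := plu_swap3 alt
  have z1 : ∀ i k l, plu M i i k l = 0 := by intros; simp only [plu, diag]; ring
  have z2 : ∀ i j l, plu M i j j l = 0 := by intros; simp [plu, diag]
  have z3 : ∀ i j k, plu M i j k k = 0 := by intros; simp only [plu, diag]; ring
  have h0 : plu M 1 2 3 4 = 0 := by
    have := h 0
    exact (((isUnit_one.neg).pow _).mul_right_eq_zero).1 this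
  have h1 : plu M 0 2 3 4 = 0 := by
    have := h 1
    exact (((isUnit_one.neg).pow _).mul_right_eq_zero).1 this
  have h2 : plu M 0 1 3 4 = 0 := by
    have := h 2
    exact (((isUnit_one.neg).pow _).mul_right_eq_zero).1 this
  have h3 : plu M 0 1 2 4 = 0 := by
    have := h 3
    exact (((isUnit_one.neg).pow _).mul_right_eq_zero).1 this
  have h4 : plu M 0 1 2 3 = 0 := by
    have := h 4
    exact (((isUnit_one.neg).pow _).mul_right_eq_zero).1 this
  have L1 : ∀ i j k l : Fin 5, i < j → j < k → k < l → plu M i j k l = 0 := by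
    intro i j k l a b c
    have : (i = 1 ∧ j = 2 ∧ k = 3 ∧ l = 4) ∨ (i = 0 ∧ j = 2 ∧ k = 3 ∧ l = 4) ∨
      (i = 0 ∧ j = 1 ∧ k = 3 ∧ l = 4) ∨ (i = 0 ∧ j = 1 ∧ k = 2 ∧ l = 4) ∨
      (i = 0 ∧ j = 1 ∧ k = 2 ∧ l = 3) := by omega
    rcases this with ⟨rfl, rfl, rfl, rfl⟩ | ⟨rfl, rfl, rfl, rfl⟩ | ⟨rfl, rfl, rfl, rfl⟩ |
      ⟨rfl, rfl, rfl, rfl⟩ | ⟨rfl, rfl, rfl, rfl⟩ <;> assumption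
  have L2 : ∀ i j k l : Fin 5, i < j → j < k → plu M i j k l = 0 := by
    intro i j k l a b
    rcases lt_trichotomy k l with c | rfl | c
    · exact L1 _ _ _ _ a b c
    · exact z3 _ _ _
    rw [s3, neg_eq_zero]
    rcases lt_trichotomy j l with d | rfl | d
    · exact L1 _ _ _ _ a d c
    · exact z2 _ _ _
    rw [s2, neg_eq_zero]
    rcases lt_trichotomy i l with e | rfl | e
    · exact L1 _ _ _ _ e d b
    · exact z1 _ _ _
    rw [s1, neg_eq_zero]
    exact L1 _ _ _ _ e a b
  have L3 : ∀ i j k l : Fin 5, i < j → plu M i j k l = 0 := by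
    intro i j k l a
    rcases lt_trichotomy j k with d | rfl | d
    · exact L2 _ _ _ _ a d
    · exact z2 _ _ _
    rw [s2, neg_eq_zero]
    rcases lt_trichotomy i k with e | rfl | e
    · exact L2 _ _ _ _ e d
    · exact z1 _ _ _
    rw [s1, neg_eq_zero]
    exact L2 _ _ _ _ e a
  rcases lt_trichotomy i j with e | rfl | e
  · exact L3 _ _ _ _ e
  · exact z1 _ _ _
  rw [s1, neg_eq_zero]
  exact L3 _ _ _ _ e

/-- congruence action -/
noncomputable def cg (T : Matrix (Fin 5) (Fin 5) K)
    (M : Matrix (Fin 5) (Fin 5) (MvPolynomial (Fin 5) K)) :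
    Matrix (Fin 5) (Fin 5) (MvPolynomial (Fin 5) K) :=
  (T.map C) * M * (T.map C)ᵀ

lemma cg_apply (T : Matrix (Fin 5) (Fin 5) K)
    (M : Matrix (Fin 5) (Fin 5) (MvPolynomial (Fin 5) K)) (i j : Fin 5) :
    cg T M i j = ∑ a, ∑ b, C (T i a) * C (T j b) * M a b := by
  simp only [cg, Matrix.mul_apply, Matrix.map_apply, Matrix.transpose_apply, Finset.sum_mul]
  rw [Finset.sum_comm]
  refine Finset.sum_congr rfl fun a _ => Finset.sum_congr rfl fun b _ => by ring

lemma cg_cg (T U : Matrix (Fin 5) (Fin 5) K)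
    (M : Matrix (Fin 5) (Fin 5) (MvPolynomial (Fin 5) K)) :
    cg T (cg U M) = cg (T * U) M := by
  simp [cg, Matrix.map_mul, Matrix.transpose_mul, Matrix.mul_assoc]

lemma cg_one (M : Matrix (Fin 5) (Fin 5) (MvPolynomial (Fin 5) K)) : cg 1 M = M := by
  rw [cg, Matrix.map_one _ C.map_zero C.map_one]; simp

lemma cg_mul (T : Matrix (Fin 5) (Fin 5) K)
    (M : Matrix (Fin 5) (Fin 5) (MvPolynomial (Fin 5) K)) (i j k l : Fin 5) :
    cg T M i j * cg T M k l = ∑ a, ∑ b, ∑ c, ∑ d,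
      C (T i a) * C (T j b) * C (T k c) * C (T l d) * (M a b * M c d) := by
  rw [cg_apply, cg_apply, Finset.sum_mul]
  simp only [Finset.sum_mul]
  simp only [Finset.mul_sum]
  refine Finset.sum_congr rfl fun a _ => Finset.sum_congr rfl fun b _ =>
    Finset.sum_congr rfl fun c _ => Finset.sum_congr rfl fun d _ => by ring

lemma plu_cg (T : Matrix (Fin 5) (Fin 5) K)
    (M : Matrix (Fin 5) (Fin 5) (MvPolynomial (Fin 5) K)) (i j k l : Fin 5) :
    plu (cg T M) i j k l = ∑ a, ∑ b, ∑ c, ∑ d,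
      C (T i a) * C (T j b) * C (T k c) * C (T l d) * plu M a b c d := by
  have e1 := cg_mul T M i j k l
  have e2 : cg T M i k * cg T M j l = ∑ a, ∑ b, ∑ c, ∑ d,
      C (T i a) * C (T j b) * C (T k c) * C (T l d) * (M a c * M b d) := by
    rw [cg_mul]
    refine Finset.sum_congr rfl fun a _ => ?_
    rw [Finset.sum_comm]
    refine Finset.sum_congr rfl fun b _ =>
      Finset.sum_congr rfl fun c _ => Finset.sum_congr rfl fun d _ => by ring
  have e3 : cg T M i l * cg T M j k = ∑ a, ∑ b, ∑ c, ∑ d,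
      C (T i a) * C (T j b) * C (T k c) * C (T l d) * (M a d * M b c) := by
    rw [cg_mul]
    refine Finset.sum_congr rfl fun a _ => ?_
    rw [Finset.sum_comm]
    refine Finset.sum_congr rfl fun b _ => ?_
    rw [Finset.sum_comm]
    refine Finset.sum_congr rfl fun c _ => Finset.sum_congr rfl fun d _ => by ring
  rw [plu, e1, e2, e3]
  simp only [← Finset.sum_add_distrib, ← Finset.sum_sub_distrib]
  refine Finset.sum_congr rfl fun a _ => Finset.sum_congr rfl fun b _ =>
    Finset.sum_congr rfl fun c _ => Finset.sum_congr rfl fun d _ => by rw [plu]; ring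

lemma Good.cg {M : Matrix (Fin 5) (Fin 5) (MvPolynomial (Fin 5) K)} (h : Good M)
    (T : Matrix (Fin 5) (Fin 5) K) : Good (cg T M) := by
  have alt : ∀ i j, _root_.cg T M i j = - _root_.cg T M j i := by
    intro i j
    rw [cg_apply, cg_apply, Finset.sum_comm, ← Finset.sum_neg_distrib]
    refine Finset.sum_congr rfl fun a _ => ?_
    rw [← Finset.sum_neg_distrib]
    refine Finset.sum_congr rfl fun b _ => ?_
    rw [h.alt b a]; ring
  refine ⟨?_, alt, ?_, ?_⟩
  · intro i j
    rw [cg_apply]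
    refine IsHomogeneous.sum _ _ _ fun a _ => IsHomogeneous.sum _ _ _ fun b _ => ?_
    rw [← C_mul]
    exact (h.lin a b).C_mul _
  · intro i
    rw [cg_apply]
    simp only [Fin.sum_univ_five, h.diag, h.alt 1 0, h.alt 2 0, h.alt 3 0, h.alt 4 0,
      h.alt 2 1, h.alt 3 1, h.alt 4 1, h.alt 3 2, h.alt 4 2, h.alt 4 3]
    ring
  · intro i j k l
    rw [plu_cg]
    simp [h.plu]


def Concl (M : Matrix (Fin 5) (Fin 5) (MvPolynomial (Fin 5) K)) : Prop :=
  ∃ T : Matrix (Fin 5) (Fin 5) K, IsUnit T.det ∧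
    ((cg T M 1 2 = 0 ∧ cg T M 1 3 = 0 ∧ cg T M 1 4 = 0 ∧ cg T M 2 3 = 0 ∧ cg T M 2 4 = 0 ∧
      cg T M 3 4 = 0) ∨
     (cg T M 0 3 = 0 ∧ cg T M 0 4 = 0 ∧ cg T M 1 3 = 0 ∧ cg T M 1 4 = 0 ∧ cg T M 2 3 = 0 ∧
      cg T M 2 4 = 0 ∧ cg T M 3 4 = 0 ∧
      LinearIndependent K ![cg T M 0 1, cg T M 0 2, cg T M 1 2]))

lemma Concl.of_cg {M : Matrix (Fin 5) (Fin 5) (MvPolynomial (Fin 5) K)}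
    {T : Matrix (Fin 5) (Fin 5) K} (hT : IsUnit T.det) (h : Concl (cg T M)) : Concl M := by
  obtain ⟨U, hU, h⟩ := h
  rw [cg_cg] at h
  exact ⟨U * T, by rw [Matrix.det_mul]; exact hU.mul hT, h⟩

lemma stageC {M : Matrix (Fin 5) (Fin 5) (MvPolynomial (Fin 5) K)} (h : Good M)
    (h23 : M 2 3 = 0) (h24 : M 2 4 = 0) (h34 : M 3 4 = 0) (hb : M 1 2 ≠ 0) : Concl M := by
  have h10 := h.alt 1 0
  have h20 := h.alt 2 0
  have h30 := h.alt 3 0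
  have h40 := h.alt 4 0
  have h21 := h.alt 2 1
  have h31 := h.alt 3 1
  have h41 := h.alt 4 1
  have h32 := h.alt 3 2
  have h42 := h.alt 4 2
  have h43 := h.alt 4 3
  rw [h23, neg_zero] at h32
  rw [h24, neg_zero] at h42
  rw [h34, neg_zero] at h43
  have p3 := h.plu 0 1 2 3
  have p4 := h.plu 0 1 2 4
  rw [plu, h23] at p3
  rw [plu, h24] at p4
  have hd := h.diag
  by_cases hdv : M 1 2 ∣ M 0 2
  · obtain ⟨t, ht⟩ := dvd_hom (h.lin 0 2) (h.lin 1 2) hdv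
    have h03 : M 0 3 = C t * M 1 3 := by
      apply mul_right_cancel₀ hb
      linear_combination p3 + M 1 3 * ht
    have h04 : M 0 4 = C t * M 1 4 := by
      apply mul_right_cancel₀ hb
      linear_combination p4 + M 1 4 * ht
    refine ⟨!![0,1,0,0,0; 1,-t,0,0,0; 0,0,1,0,0; 0,0,0,1,0; 0,0,0,0,1], ?_, Or.inl ?_⟩
    · simp [Matrix.det_succ_row_zero, Fin.sum_univ_succ, Fin.succAbove]
    · refine ⟨?_, ?_, ?_, ?_, ?_, ?_⟩ <;>
        simp [cg_apply, Fin.sum_univ_five, h23, h24, h34, ht, h03, h04]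
  have hp := prime_hom (h.lin 1 2) hb
  have key : ∀ a b : MvPolynomial (Fin 5) K, b.IsHomogeneous 1 →
      M 0 2 * b = a * M 1 2 → ∃ t, b = C t * M 1 2 ∧ a = C t * M 0 2 := by
    intro a b hb1 hab
    have : M 1 2 ∣ M 0 2 * b := ⟨a, by rw [hab, mul_comm]⟩
    obtain ⟨t, ht⟩ := dvd_hom hb1 (h.lin 1 2) ((hp.dvd_or_dvd this).resolve_left hdv)
    refine ⟨t, ht, ?_⟩
    apply mul_right_cancel₀ hb
    rw [← hab, ht]; ring
  obtain ⟨t3, h13, h03⟩ := key (M 0 3) (M 1 3) (h.lin 1 3) (by linear_combination -p3)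
  obtain ⟨t4, h14, h04⟩ := key (M 0 4) (M 1 4) (h.lin 1 4) (by linear_combination -p4)
  by_cases hli : LinearIndependent K ![M 0 1, M 0 2, M 1 2]
  · refine ⟨!![1,0,0,0,0; 0,1,0,0,0; 0,0,1,0,0; 0,0,-t3,1,0; 0,0,-t4,0,1], ?_, Or.inr ?_⟩
    · simp [Matrix.det_succ_row_zero, Fin.sum_univ_succ, Fin.succAbove]
    · refine ⟨?_, ?_, ?_, ?_, ?_, ?_, ?_, ?_⟩
      on_goal 8 => simpa [cg_apply, Fin.sum_univ_five] using hli
      all_goals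
        simp [cg_apply, Fin.sum_univ_five, h23, h24, h34, h13, h14, h03, h04, h32, h42, h43, hd]
  · have hab : LinearIndependent K ![M 0 2, M 1 2] := by
      rw [LinearIndependent.pair_iff]
      intro s t hst
      rw [smul_eq_C_mul, smul_eq_C_mul] at hst
      have hs : s = 0 := by
        by_contra hs
        apply hdv
        refine ⟨-C (s⁻¹ * t), ?_⟩
        have hc : (C s⁻¹ : MvPolynomial (Fin 5) K) * C s = 1 := by
          rw [← C_mul, inv_mul_cancel₀ hs, C_1]
        rw [C_mul]
        linear_combination (C s⁻¹) * hst - M 0 2 * hc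
      subst hs
      refine ⟨rfl, ?_⟩
      simpa [hb] using hst
    have hmem : M 0 1 ∈ Submodule.span K (Set.range ![M 0 2, M 1 2]) := by
      by_contra hn
      exact hli (linearIndependent_finCons.2 ⟨hab, hn⟩)
    rw [Matrix.range_cons, Matrix.range_cons, Matrix.range_empty, Set.union_empty,
      Set.singleton_union, Submodule.mem_span_pair] at hmem
    obtain ⟨s, t, hst⟩ := hmem
    rw [smul_eq_C_mul, smul_eq_C_mul] at hst
    refine ⟨!![0,0,1,0,0; 1,0,t,0,0; 0,1,-s,0,0; 0,0,-t3,1,0; 0,0,-t4,0,1], ?_, Or.inl ?_⟩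
    · simp [Matrix.det_succ_row_zero, Fin.sum_univ_succ, Fin.succAbove]
    · refine ⟨?_, ?_, ?_, ?_, ?_, ?_⟩ <;>
        simp [cg_apply, Fin.sum_univ_five, h23, h24, h34, h13, h14, h03, h04, h32, h42, h43, hd,
          ← hst, h21]

lemma exists_perm (i j : Fin 5) (hij : i ≠ j) : ∃ σ : Equiv.Perm (Fin 5), σ 0 = i ∧ σ 1 = j := by
  refine ⟨Equiv.swap 0 i * Equiv.swap 1 (Equiv.swap 0 i j), ?_, ?_⟩
  · rw [Equiv.Perm.mul_apply, Equiv.swap_apply_of_ne_of_ne (a := 1) (by decide),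
      Equiv.swap_apply_left]
    intro h
    have := congrArg (Equiv.swap 0 i) h
    rw [Equiv.swap_apply_self, Equiv.swap_apply_left] at this
    exact hij this
  · rw [Equiv.Perm.mul_apply, Equiv.swap_apply_left, Equiv.swap_apply_self]

lemma cg_perm (M : Matrix (Fin 5) (Fin 5) (MvPolynomial (Fin 5) K)) (σ : Equiv.Perm (Fin 5)) :
    ∃ T : Matrix (Fin 5) (Fin 5) K, IsUnit T.det ∧ ∀ i j, cg T M i j = M (σ i) (σ j) := by
  refine ⟨(1 : Matrix (Fin 5) (Fin 5) K).submatrix σ id, ?_, ?_⟩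
  · rw [Matrix.det_permute]
    simp
    exact (Int.units_eq_one_or (Equiv.Perm.sign σ)).elim (fun h => by simp [h])
      (fun h => by simp [h])
  · intro i j
    rw [cg_apply]
    simp [Matrix.one_apply]

lemma stageB {M : Matrix (Fin 5) (Fin 5) (MvPolynomial (Fin 5) K)} (h : Good M)
    (h23 : M 2 3 = 0) (h24 : M 2 4 = 0) (h34 : M 3 4 = 0) : Concl M := by
  by_cases h2 : M 1 2 = 0
  · by_cases h3 : M 1 3 = 0
    · by_cases h4 : M 1 4 = 0
      · exact ⟨1, by simp, Or.inl (by simp only [cg_one]; exact ⟨h2, h3, h4, h23, h24, h34⟩)⟩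
      · obtain ⟨T, hT, e⟩ := cg_perm M (Equiv.swap 2 4)
        refine Concl.of_cg hT (stageC (h.cg T) ?_ ?_ ?_ ?_) <;> rw [e]
        · exact (h.alt 4 3).trans (by rw [h34, neg_zero])
        · exact (h.alt 4 2).trans (by rw [h24, neg_zero])
        · exact (h.alt 3 2).trans (by rw [h23, neg_zero])
        · exact h4
    · obtain ⟨T, hT, e⟩ := cg_perm M (Equiv.swap 2 3)
      refine Concl.of_cg hT (stageC (h.cg T) ?_ ?_ ?_ ?_) <;> rw [e]
      · exact (h.alt 3 2).trans (by rw [h23, neg_zero])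
      · exact h34
      · exact h24
      · exact h3
  · exact stageC h h23 h24 h34 h2

lemma lc_add (k : Fin 5) (f g : MvPolynomial (Fin 5) K) : lc k (f + g) = lc k f + lc k g := by
  simp [lc]
lemma lc_neg (k : Fin 5) (f : MvPolynomial (Fin 5) K) : lc k (-f) = - lc k f := by
  simp [lc]
lemma lc_C_mul (k : Fin 5) (a : K) (f : MvPolynomial (Fin 5) K) :
    lc k (C a * f) = a * lc k f := by
  simp [lc]

lemma stageA2 {M : Matrix (Fin 5) (Fin 5) (MvPolynomial (Fin 5) K)} (h : Good M) {k : Fin 5}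
    (h01 : lc k (M 0 1) = 1) (h02 : lc k (M 0 2) = 0) (h03 : lc k (M 0 3) = 0)
    (h04 : lc k (M 0 4) = 0) (h12 : lc k (M 1 2) = 0) (h13 : lc k (M 1 3) = 0)
    (h14 : lc k (M 1 4) = 0) : Concl M := by
  refine stageB h ?_ ?_ ?_
  · exact key_vanish (h.lin _ _) (h.lin _ _) (h.lin _ _) (h.lin _ _) (h.lin _ _) (h.lin _ _)
      h01 h02 h13 h03 h12 (h.plu 0 1 2 3)
  · exact key_vanish (h.lin _ _) (h.lin _ _) (h.lin _ _) (h.lin _ _) (h.lin _ _) (h.lin _ _)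
      h01 h02 h14 h04 h12 (h.plu 0 1 2 4)
  · exact key_vanish (h.lin _ _) (h.lin _ _) (h.lin _ _) (h.lin _ _) (h.lin _ _) (h.lin _ _)
      h01 h03 h14 h04 h13 (h.plu 0 1 3 4)

lemma stageA1 {M : Matrix (Fin 5) (Fin 5) (MvPolynomial (Fin 5) K)} (h : Good M) {k : Fin 5}
    (h01 : lc k (M 0 1) ≠ 0) : Concl M := by
  have h10 := h.alt 1 0
  have h21 := h.alt 2 1
  have h31 := h.alt 3 1
  have h41 := h.alt 4 1
  have hd := h.diag
  obtain ⟨c, hc⟩ : ∃ c, c = lc k (M 0 1) := ⟨_, rfl⟩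
  rw [← hc] at h01
  let T : Matrix (Fin 5) (Fin 5) K := !![1,0,0,0,0; 0,c⁻¹,0,0,0;
    lc k (M 1 2) / c, - lc k (M 0 2) / c, 1,0,0;
    lc k (M 1 3) / c, - lc k (M 0 3) / c, 0,1,0;
    lc k (M 1 4) / c, - lc k (M 0 4) / c, 0,0,1]
  have hT : IsUnit T.det := by
    simp [T, Matrix.det_succ_row_zero, Fin.sum_univ_succ, Fin.succAbove, h01]
  refine Concl.of_cg hT (stageA2 (h.cg T) (k := k) ?_ ?_ ?_ ?_ ?_ ?_ ?_) <;>
    simp [T, cg_apply, Fin.sum_univ_five, hd, h10, lc_add, lc_C_mul, lc_neg, ← hc,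
      mul_assoc, -map_inv₀, -map_div₀, -map_mul] <;> field_simp <;> try ring

lemma concl_of_good {M : Matrix (Fin 5) (Fin 5) (MvPolynomial (Fin 5) K)} (h : Good M) :
    Concl M := by
  by_cases h0 : ∀ i j, M i j = 0
  · exact ⟨1, by simp, Or.inl (by simp [cg_one, h0])⟩
  push Not at h0
  obtain ⟨i, j, hij⟩ := h0
  have hne : i ≠ j := by rintro rfl; exact hij (h.diag i)
  obtain ⟨σ, s0, s1⟩ := exists_perm i j hne
  obtain ⟨T, hT, e⟩ := cg_perm M σ
  obtain ⟨k, hk⟩ := exists_lc_ne_zero (h.lin i j) hij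
  exact Concl.of_cg hT (stageA1 (h.cg T) (k := k) (by rw [e, s0, s1]; exact hk))

lemma linForm_inj {ι : Type*} {v : ι → Fin 5 → K}
    (h : LinearIndependent K fun i => linForm (v i)) : LinearIndependent K v := by
  let L : (Fin 5 → K) →ₗ[K] MvPolynomial (Fin 5) K :=
    { toFun := linForm
      map_add' := by intro a b; simp [linForm, add_mul, Finset.sum_add_distrib]
      map_smul' := by
        intro a b
        simp [linForm, Finset.mul_sum, smul_eq_C_mul, mul_assoc] }
  exact LinearIndependent.of_comp L h

lemma subst_linForm (B : Matrix (Fin 5) (Fin 5) K) (v : Fin 5 → K) :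
    (aeval fun k => ∑ l, C (B l k) * X l) (linForm v) = linForm (B *ᵥ v) := by
  simp only [linForm, map_sum, map_mul, aeval_X, Matrix.mulVec, dotProduct, Finset.mul_sum,
    Finset.sum_mul, algHom_C]
  rw [Finset.sum_comm]
  refine Finset.sum_congr rfl fun a _ => Finset.sum_congr rfl fun b _ => ?_
  simp [algebraMap_eq]; ring

lemma exists_extend {v : Fin 3 → Fin 5 → K} (hv : LinearIndependent K v) :
    ∃ w : Matrix (Fin 5) (Fin 5) K, IsUnit w ∧ w 0 = v 0 ∧ w 1 = v 1 ∧ w 2 = v 2 := by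
  obtain ⟨x, hx⟩ := exists_linearIndependent_snoc_of_lt_finrank hv (by simp)
  obtain ⟨y, hy⟩ := exists_linearIndependent_snoc_of_lt_finrank hx (by simp)
  exact ⟨Matrix.of (Fin.snoc (Fin.snoc v x : Fin 4 → Fin 5 → K) y),
    Matrix.linearIndependent_rows_iff_isUnit.1 hy, rfl, rfl, rfl⟩

lemma exists_subst {f g h : MvPolynomial (Fin 5) K} (hf : f.IsHomogeneous 1)
    (hg : g.IsHomogeneous 1) (hh : h.IsHomogeneous 1)
    (hli : LinearIndependent K ![f, g, h]) : ∃ B : Matrix (Fin 5) (Fin 5) K, IsUnit B.det ∧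
      (aeval fun k => ∑ l, C (B l k) * X l) f = (X 0 : MvPolynomial (Fin 5) K) ∧
      (aeval fun k => ∑ l, C (B l k) * X l) g = (X 1 : MvPolynomial (Fin 5) K) ∧
      (aeval fun k => ∑ l, C (B l k) * X l) h = (X 2 : MvPolynomial (Fin 5) K) := by
  obtain ⟨u, rfl⟩ := exists_linForm hf
  obtain ⟨v, rfl⟩ := exists_linForm hg
  obtain ⟨z, rfl⟩ := exists_linForm hh
  have hli' : LinearIndependent K ![u, v, z] := by
    apply linForm_inj
    convert hli using 1
    funext i
    fin_cases i <;> rfl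
  obtain ⟨w, hw, w0, w1, w2⟩ := exists_extend hli'
  have hwd : IsUnit (wᵀ).det := by
    rw [Matrix.det_transpose]; exact (Matrix.isUnit_iff_isUnit_det _).1 hw
  have key : ∀ j : Fin 5, linForm ((wᵀ)⁻¹ *ᵥ w j) = X j := by
    intro j
    have e : w j = wᵀ *ᵥ Pi.single j 1 := by
      rw [Matrix.mulVec_single_one]
      rfl
    rw [e, Matrix.mulVec_mulVec, Matrix.nonsing_inv_mul _ hwd, Matrix.one_mulVec]
    simp [linForm, Pi.single_apply]
  refine ⟨(wᵀ)⁻¹, Matrix.isUnit_nonsing_inv_det _ hwd, ?_, ?_, ?_⟩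
  · rw [subst_linForm, ← key 0, w0]; rfl
  · rw [subst_linForm, ← key 1, w1]; rfl
  · rw [subst_linForm, ← key 2, w2]; rfl

end helpers

/-- A genus one model of degree 5 over a field whose 4×4 Pfaffians all vanish
is equivalent to a model supported in the first row, or to the model with
`φ₁₂ = x₁`, `φ₁₃ = x₂`, `φ₂₃ = x₃` and all other upper entries zero. -/
theorem pfaffians_zero_classification {K : Type*} [Field K]
    (Φ : Matrix (Fin 5) (Fin 5) (MvPolynomial (Fin 5) K))
    (hlin : ∀ i j, (Φ i j).IsHomogeneous 1)
    (halt : Φᵀ = -Φ) (hdiag : ∀ i, Φ i i = 0)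
    (hpf : ∀ i, signedPf Φ i = 0) :
    ∃ A B : Matrix (Fin 5) (Fin 5) K, IsUnit A.det ∧ IsUnit B.det ∧
      ((∀ i j : Fin 5, i ≠ 0 → j ≠ 0 → transformModel A B Φ i j = 0) ∨
       (transformModel A B Φ 0 1 = X 0 ∧ transformModel A B Φ 0 2 = X 1 ∧
        transformModel A B Φ 1 2 = X 2 ∧ transformModel A B Φ 0 3 = 0 ∧
        transformModel A B Φ 0 4 = 0 ∧ transformModel A B Φ 1 3 = 0 ∧
        transformModel A B Φ 1 4 = 0 ∧ transformModel A B Φ 2 3 = 0 ∧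
        transformModel A B Φ 2 4 = 0 ∧ transformModel A B Φ 3 4 = 0)) := by
  have alt : ∀ i j, Φ i j = - Φ j i := fun i j => by
    have := congrFun (congrFun halt j) i
    simpa using this
  have hG : Good Φ := ⟨hlin, alt, hdiag, plu_all alt hdiag hpf⟩
  obtain ⟨A, hA, h⟩ := concl_of_good hG
  have hN := hG.cg A
  have tr : ∀ B i j, transformModel A B Φ i j =
      (aeval fun k => ∑ l, C (B l k) * X l) (cg A Φ i j) := fun B i j => rfl
  rcases h with ⟨h12, h13, h14, h23, h24, h34⟩ | ⟨h03, h04, h13, h14, h23, h24, h34, hli⟩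
  · refine ⟨A, 1, hA, by simp, Or.inl ?_⟩
    have lt0 : ∀ i j : Fin 5, i ≠ 0 → i < j → cg A Φ i j = 0 := by
      intro i j hi hij
      have : (i = 1 ∧ j = 2) ∨ (i = 1 ∧ j = 3) ∨ (i = 1 ∧ j = 4) ∨ (i = 2 ∧ j = 3) ∨
        (i = 2 ∧ j = 4) ∨ (i = 3 ∧ j = 4) := by omega
      rcases this with ⟨rfl, rfl⟩ | ⟨rfl, rfl⟩ | ⟨rfl, rfl⟩ | ⟨rfl, rfl⟩ | ⟨rfl, rfl⟩ |
        ⟨rfl, rfl⟩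
      · exact h12
      · exact h13
      · exact h14
      · exact h23
      · exact h24
      · exact h34
    intro i j hi hj
    rw [tr]
    have : cg A Φ i j = 0 := by
      rcases lt_trichotomy i j with hij | rfl | hij
      · exact lt0 i j hi hij
      · exact hN.diag i
      · rw [hN.alt, lt0 j i hj hij, neg_zero]
    rw [this, map_zero]
  · obtain ⟨B, hB, s0, s1, s2⟩ := exists_subst (hN.lin 0 1) (hN.lin 0 2) (hN.lin 1 2) hli
    refine ⟨A, B, hA, hB, Or.inr ?_⟩
    rw [tr, tr, tr, tr, tr, tr, tr, tr, tr, tr, h03, h04, h13, h14, h23, h24, h34, map_zero]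
    exact ⟨s0, s1, s2, rfl, rfl, rfl, rfl, rfl, rfl, rfl⟩
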